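/- Let G be a discrete group and I a nonempty set, and let T = I×G×I. Then the Banach algebra ℓ¹(T) is self-induced and is Morita equivalent (in the sense of Grønbæk) to ℓ¹(G). -/

import Mathlib

open scoped TensorProduct BigOperators ENNReal
open Filter

noncomputable section

/-- `ℓ¹(X)`: the Banach space of absolutely summable complex functions on `X`. -/
abbrev L1 (X : Type) : Type := lp (fun _ : X => ℂ) 1

open Classical in
/-- The point mass `δ_x` in `ℓ¹(X)`. -/
noncomputable def delta {X : Type} (x : X) : L1 X := lp.single 1 x (1 : ℂ)

/-- The projective tensor norm of an element of the algebraic tensor product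
`E ⊗[ℂ] F`: the infimum of `∑ ‖xᵢ‖ ‖yᵢ‖` over all finite representations
`z = ∑ xᵢ ⊗ yᵢ`. -/
def projNorm {E F : Type} [SeminormedAddCommGroup E] [NormedSpace ℂ E]
    [SeminormedAddCommGroup F] [NormedSpace ℂ F] (z : E ⊗[ℂ] F) : ℝ :=
  sInf {r : ℝ | ∃ (n : ℕ) (x : Fin n → E) (y : Fin n → F),
    z = ∑ i, x i ⊗ₜ[ℂ] y i ∧ r = ∑ i, ‖x i‖ * ‖y i‖}

/-- `(T, φ)` is a realization of the completed projective tensor product `E ⊗̂ F`: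
`T` is a Banach space, the canonical map from the algebraic tensor product is an
isometry with respect to the projective tensor norm, and it has dense range. -/
structure IsProjTensor (E F T : Type) [SeminormedAddCommGroup E] [NormedSpace ℂ E]
    [SeminormedAddCommGroup F] [NormedSpace ℂ F]
    [SeminormedAddCommGroup T] [NormedSpace ℂ T]
    (φ : E →ₗ[ℂ] F →ₗ[ℂ] T) : Prop where
  complete : CompleteSpace T
  isometry : ∀ z : E ⊗[ℂ] F, ‖TensorProduct.lift φ z‖ = projNorm z
  dense : DenseRange ⇑(TensorProduct.lift φ)

/-- The closed linear span of the `A`-balancing relations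
`{x·a ⊗ y - x ⊗ a·y}` inside a realization `T` of `E ⊗̂ F`; the quotient
`T ⧸ balancer φ r l` is the `A`-module tensor product `E ⊗̂_A F`. -/
def balancer {A E F T : Type} [SeminormedAddCommGroup E] [NormedSpace ℂ E]
    [SeminormedAddCommGroup F] [NormedSpace ℂ F]
    [SeminormedAddCommGroup T] [NormedSpace ℂ T]
    (φ : E →ₗ[ℂ] F →ₗ[ℂ] T) (r : E → A → E) (l : A → F → F) : Submodule ℂ T :=
  (Submodule.span ℂ {z : T | ∃ (x : E) (a : A) (y : F), z = φ (r x a) y - φ x (l a y)}).topologicalClosure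

/-- A left Banach `A`-module `(E, l)` is `A`-induced: for every realization `T` of
`A ⊗̂ E`, the canonical map `A ⊗̂_A E → E`, `a ⊗ x ↦ a·x`, is a topological
isomorphism. -/
def LeftInduced {A E : Type} [SeminormedAddCommGroup A] [NormedSpace ℂ A]
    [SeminormedAddCommGroup E] [NormedSpace ℂ E]
    (mulA : A →L[ℂ] A →L[ℂ] A) (l : A →L[ℂ] E →L[ℂ] E) : Prop :=
  ∀ (T : Type) [SeminormedAddCommGroup T] [NormedSpace ℂ T]
    (φ : A →ₗ[ℂ] E →ₗ[ℂ] T), IsProjTensor A E T φ →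
    ∃ e : (T ⧸ balancer φ (fun a b => mulA a b) (fun a x => l a x)) ≃L[ℂ] E,
      ∀ (a : A) (x : E), e (Submodule.Quotient.mk (φ a x)) = l a x

/-- A right Banach `A`-module `(E, r)` is `A`-induced. -/
def RightInduced {A E : Type} [SeminormedAddCommGroup A] [NormedSpace ℂ A]
    [SeminormedAddCommGroup E] [NormedSpace ℂ E]
    (mulA : A →L[ℂ] A →L[ℂ] A) (r : E →L[ℂ] A →L[ℂ] E) : Prop :=
  ∀ (T : Type) [SeminormedAddCommGroup T] [NormedSpace ℂ T]
    (φ : E →ₗ[ℂ] A →ₗ[ℂ] T), IsProjTensor E A T φ →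
    ∃ e : (T ⧸ balancer φ (fun x a => r x a) (fun a b => mulA a b)) ≃L[ℂ] E,
      ∀ (x : E) (a : A), e (Submodule.Quotient.mk (φ x a)) = r x a

/-- A Banach algebra `(A, mul)` is self-induced: the multiplication map
`A ⊗̂_A A → A` is an isomorphism of `A`-bimodules. -/
def SelfInduced {A : Type} [SeminormedAddCommGroup A] [NormedSpace ℂ A]
    (mulA : A →L[ℂ] A →L[ℂ] A) : Prop :=
  ∀ (T : Type) [SeminormedAddCommGroup T] [NormedSpace ℂ T]
    (φ : A →ₗ[ℂ] A →ₗ[ℂ] T), IsProjTensor A A T φ →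
    ∃ e : (T ⧸ balancer φ (fun a b => mulA a b) (fun a b => mulA a b)) ≃L[ℂ] A,
      (∀ a b : A, e (Submodule.Quotient.mk (φ a b)) = mulA a b) ∧
      (∀ c a b : A, e (Submodule.Quotient.mk (φ (mulA c a) b))
          = mulA c (e (Submodule.Quotient.mk (φ a b)))) ∧
      (∀ a b c : A, e (Submodule.Quotient.mk (φ a (mulA b c)))
          = mulA (e (Submodule.Quotient.mk (φ a b))) c)

/-- `(E, l, r)` is a Banach bimodule: left over `(A, mulL)`, right over `(B, mulR)`. -/
def IsBimoduleLaw {A B E : Type} [SeminormedAddCommGroup A] [NormedSpace ℂ A]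
    [SeminormedAddCommGroup B] [NormedSpace ℂ B]
    [SeminormedAddCommGroup E] [NormedSpace ℂ E]
    (mulL : A →L[ℂ] A →L[ℂ] A) (mulR : B →L[ℂ] B →L[ℂ] B)
    (l : A →L[ℂ] E →L[ℂ] E) (r : E →L[ℂ] B →L[ℂ] E) : Prop :=
  (∀ (a a' : A) (x : E), l (mulL a a') x = l a (l a' x)) ∧
  (∀ (x : E) (b b' : B), r (r x b) b' = r x (mulR b b')) ∧
  (∀ (a : A) (x : E) (b : B), r (l a x) b = l a (r x b))

/-- A witness for Morita equivalence of `(A, mulA)` and `(B, mulB)` in the sense of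
Grønbæk's characterization: two-sided induced Banach bimodules `P ∈ B-mod-A` and
`Q ∈ A-mod-B` with `P ⊗̂_A Q ≅ B` and `Q ⊗̂_B P ≅ A` as bimodules. -/
structure MoritaWitness (A B : Type) [NormedAddCommGroup A] [NormedSpace ℂ A]
    [NormedAddCommGroup B] [NormedSpace ℂ B]
    (mulA : A →L[ℂ] A →L[ℂ] A) (mulB : B →L[ℂ] B →L[ℂ] B) : Type 1 where
  P : Type
  Q : Type
  [iP1 : NormedAddCommGroup P] [iP2 : NormedSpace ℂ P] [iP3 : CompleteSpace P]
  [iQ1 : NormedAddCommGroup Q] [iQ2 : NormedSpace ℂ Q] [iQ3 : CompleteSpace Q]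
  lP : B →L[ℂ] P →L[ℂ] P
  rP : P →L[ℂ] A →L[ℂ] P
  lQ : A →L[ℂ] Q →L[ℂ] Q
  rQ : Q →L[ℂ] B →L[ℂ] Q
  lawP : IsBimoduleLaw mulB mulA lP rP
  lawQ : IsBimoduleLaw mulA mulB lQ rQ
  indPl : LeftInduced mulB lP
  indPr : RightInduced mulA rP
  indQl : LeftInduced mulA lQ
  indQr : RightInduced mulB rQ
  isoB : ∀ (T : Type) [SeminormedAddCommGroup T] [NormedSpace ℂ T]
    (φ : P →ₗ[ℂ] Q →ₗ[ℂ] T), IsProjTensor P Q T φ →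
    ∃ e : (T ⧸ balancer φ (fun x a => rP x a) (fun a y => lQ a y)) ≃L[ℂ] B,
      (∀ (b : B) (p : P) (q : Q), e (Submodule.Quotient.mk (φ (lP b p) q))
          = mulB b (e (Submodule.Quotient.mk (φ p q)))) ∧
      (∀ (b : B) (p : P) (q : Q), e (Submodule.Quotient.mk (φ p (rQ q b)))
          = mulB (e (Submodule.Quotient.mk (φ p q))) b)
  isoA : ∀ (T : Type) [SeminormedAddCommGroup T] [NormedSpace ℂ T]
    (φ : Q →ₗ[ℂ] P →ₗ[ℂ] T), IsProjTensor Q P T φ →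
    ∃ e : (T ⧸ balancer φ (fun y b => rQ y b) (fun b x => lP b x)) ≃L[ℂ] A,
      (∀ (a : A) (q : Q) (p : P), e (Submodule.Quotient.mk (φ (lQ a q) p))
          = mulA a (e (Submodule.Quotient.mk (φ q p)))) ∧
      (∀ (a : A) (q : Q) (p : P), e (Submodule.Quotient.mk (φ q (rP p a)))
          = mulA (e (Submodule.Quotient.mk (φ q p))) a)

/-- Morita equivalence of self-induced Banach algebras, via Grønbæk's
characterization. -/
def MoritaEquivalent {A B : Type} [NormedAddCommGroup A] [NormedSpace ℂ A]
    [NormedAddCommGroup B] [NormedSpace ℂ B]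
    (mulA : A →L[ℂ] A →L[ℂ] A) (mulB : B →L[ℂ] B →L[ℂ] B) : Prop :=
  Nonempty (MoritaWitness A B mulA mulB)

/-- The Brandt semigroup `B(I,G) = (I × G × I) ∪ {∘}`, with `∘ = none`. -/
abbrev Brandt (I G : Type) : Type := Option (I × G × I)

open Classical in
/-- Multiplication of the Brandt semigroup: `(i,g,j)(i',g',j') = (i,gg',j')` if
`j = i'` and `∘` otherwise; `∘` is absorbing. -/
noncomputable instance {I G : Type} [Mul G] : Mul (Brandt I G) :=
  ⟨fun a b => match a, b with
    | some (i, g, j), some (i', g', j') => if j = i' then some (i, g * g', j') else none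
    | _, _ => none⟩

open Classical in
/-- The convolution product on `ℓ¹(S)` for a (semi)group `S`:
`(a * b)(s) = ∑_{uv = s} a(u) b(v)`. -/
noncomputable def l1conv {S : Type} [Mul S] (a b : L1 S) (s : S) : ℂ :=
  ∑' p : S × S, if p.1 * p.2 = s then a p.1 * b p.2 else 0

section Helpers

theorem l1_summable_norm {X : Type} (f : L1 X) : Summable (fun x => ‖f x‖) := by
  have := (lp.hasSum_norm (p := 1) (by simp) f).summable
  simpa using this

theorem l1_norm_eq {X : Type} (f : L1 X) : ‖f‖ = ∑' x, ‖f x‖ := by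
  have := lp.norm_eq_tsum_rpow (p := 1) (by simp) f
  simpa using this

open Classical in
theorem delta_apply {X : Type} (x y : X) : (delta x : L1 X) y = if y = x then 1 else 0 := by
  unfold delta
  rw [lp.single_apply]
  by_cases h : y = x
  · subst h; simp
  · simp [h]

theorem norm_delta {X : Type} (x : X) : ‖(delta x : L1 X)‖ = 1 := by
  classical
  unfold delta
  rw [lp.norm_single (by simp)]; simp

theorem l1_hasSum {X : Type} (f : L1 X) : HasSum (fun x => f x • (delta x : L1 X)) f := by
  classical
  have := lp.hasSum_single (p := 1) (by simp) f
  convert this using 2 with x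
  ext y
  rw [lp.coeFn_smul, Pi.smul_apply, delta_apply, lp.single_apply]
  by_cases h : y = x
  · subst h; simp
  · simp [h]

theorem l1_ext {X W : Type} [NormedAddCommGroup W] [NormedSpace ℂ W]
    {f g : L1 X →L[ℂ] W} (h : ∀ x, f (delta x) = g (delta x)) : f = g := by
  ext a
  have h1 := (l1_hasSum a).mapL f
  have h2 := (l1_hasSum a).mapL g
  simp only [map_smul, h] at h1 h2
  exact h1.unique h2

theorem l1_summable_smul {X W : Type} [NormedAddCommGroup W] [NormedSpace ℂ W] [CompleteSpace W]
    (v : X → W) (hv : ∀ x, ‖v x‖ ≤ 1) (a : L1 X) : Summable (fun x => a x • v x) := by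
  refine Summable.of_norm_bounded (l1_summable_norm a) fun x => ?_
  rw [norm_smul]
  exact mul_le_of_le_one_right (norm_nonneg _) (hv x)

/-- The universal property of `ℓ¹`. -/
def l1lift {X W : Type} [NormedAddCommGroup W] [NormedSpace ℂ W] [CompleteSpace W]
    (v : X → W) (hv : ∀ x, ‖v x‖ ≤ 1) : L1 X →L[ℂ] W :=
  LinearMap.mkContinuous
    { toFun := fun a => ∑' x, a x • v x
      map_add' := fun a b => by
        rw [← (l1_summable_smul v hv a).tsum_add (l1_summable_smul v hv b)]
        simp [add_smul]
      map_smul' := fun c a => by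
        simp [mul_smul, (l1_summable_smul v hv a).tsum_const_smul] } 1
    (fun a => by
      rw [one_mul, l1_norm_eq]
      refine tsum_of_norm_bounded (l1_summable_norm a).hasSum fun x => ?_
      rw [norm_smul]
      exact mul_le_of_le_one_right (norm_nonneg _) (hv x))

theorem l1lift_apply {X W : Type} [NormedAddCommGroup W] [NormedSpace ℂ W] [CompleteSpace W]
    (v : X → W) (hv : ∀ x, ‖v x‖ ≤ 1) (a : L1 X) : l1lift v hv a = ∑' x, a x • v x := rfl

theorem l1lift_delta {X W : Type} [NormedAddCommGroup W] [NormedSpace ℂ W] [CompleteSpace W]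
    (v : X → W) (hv : ∀ x, ‖v x‖ ≤ 1) (x : X) : l1lift v hv (delta x) = v x := by
  classical
  rw [l1lift_apply, tsum_eq_single x]
  · simp [delta_apply]
  · intro y hy
    simp [delta_apply, hy]

theorem norm_l1lift_le {X W : Type} [NormedAddCommGroup W] [NormedSpace ℂ W] [CompleteSpace W]
    (v : X → W) (hv : ∀ x, ‖v x‖ ≤ 1) : ‖l1lift v hv‖ ≤ 1 :=
  LinearMap.mkContinuous_norm_le _ zero_le_one _

/-- The point mass at an optional point. -/
def odelta {Z : Type} : Option Z → L1 Z
  | none => 0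
  | some z => delta z

theorem norm_odelta {Z : Type} (o : Option Z) : ‖odelta o‖ ≤ 1 := by
  cases o with
  | none => simp [odelta]
  | some z => exact (norm_delta z).le

/-- The bilinear convolution attached to a partial composition. -/
def conv {X Y Z : Type} (m : X → Y → Option Z) : L1 X →L[ℂ] L1 Y →L[ℂ] L1 Z :=
  l1lift (fun x => l1lift (fun y => odelta (m x y)) (fun _ => norm_odelta _))
    (fun _ => norm_l1lift_le _ _)

theorem conv_delta {X Y Z : Type} (m : X → Y → Option Z) (x : X) (y : Y) :
    conv m (delta x) (delta y) = odelta (m x y) := by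
  simp [conv, l1lift_delta]

theorem norm_conv_le {X Y Z : Type} (m : X → Y → Option Z) (a : L1 X) (b : L1 Y) :
    ‖conv m a b‖ ≤ ‖a‖ * ‖b‖ := by
  have h : ‖conv m‖ ≤ 1 := norm_l1lift_le _ _
  calc ‖conv m a b‖ ≤ ‖conv m‖ * ‖a‖ * ‖b‖ := (conv m).le_opNorm₂ a b
    _ ≤ 1 * ‖a‖ * ‖b‖ := by gcongr
    _ = _ := by ring

theorem conv_odelta_left {X Y Z : Type} (m : X → Y → Option Z) (o : Option X) (y : Y) :
    conv m (odelta o) (delta y) = odelta (o.bind (fun x => m x y)) := by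
  cases o <;> simp [odelta, conv_delta]

theorem conv_odelta_right {X Y Z : Type} (m : X → Y → Option Z) (x : X) (o : Option Y) :
    conv m (delta x) (odelta o) = odelta (o.bind (fun y => m x y)) := by
  cases o <;> simp [odelta, conv_delta]

open Classical in
theorem conv_apply {X Y Z : Type} (m : X → Y → Option Z) (a : L1 X) (b : L1 Y) (z : Z) :
    conv m a b z = ∑' p : X × Y, if m p.1 p.2 = some z then a p.1 * b p.2 else 0 := by
  have hs : Summable (fun p : X × Y => a p.1 * b p.2) :=
    summable_mul_of_summable_norm (l1_summable_norm a) (l1_summable_norm b)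
  have hs' : Summable (fun p : X × Y => if m p.1 p.2 = some z then a p.1 * b p.2 else 0) := by
    refine Summable.of_norm_bounded hs.norm fun p => ?_
    split_ifs
    · exact le_rfl
    · rw [norm_zero]; exact norm_nonneg _
  rw [hs'.tsum_prod]
  let ev : L1 Z →L[ℂ] ℂ := lp.evalCLM ℂ (fun _ : Z => ℂ) 1 z
  have hev : ∀ f : L1 Z, ev f = f z := fun f => rfl
  have h1 : conv m a b = ∑' x, a x • conv m (delta x) b := by
    have := ((l1_hasSum a).mapL ((conv m).flip b)).tsum_eq
    simpa using this.symm
  have h1s : Summable (fun x => a x • conv m (delta x) b) := by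
    have := ((l1_hasSum a).mapL ((conv m).flip b)).summable
    simpa using this
  rw [← hev, h1, ev.map_tsum h1s]
  congr 1; ext x
  have h2 := (((l1_hasSum b).mapL (conv m (delta x))).mapL ev).tsum_eq
  rw [map_smul, ← h2, smul_eq_mul, ← tsum_mul_left]
  congr 1; ext y
  simp only [map_smul, conv_delta]
  rcases h : m x y with _ | w
  · simp [odelta]
  · have hd : (odelta (some w) : L1 Z) z = if z = w then 1 else 0 := delta_apply w z
    rw [hev, hd]
    by_cases hw : w = z
    · simp [hw]
    · simp [hw, Ne.symm hw]

theorem conv_assoc {X Y V XY YV Z : Type} (m1 : X → Y → Option XY) (m2 : XY → V → Option Z)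
    (m3 : Y → V → Option YV) (m4 : X → YV → Option Z)
    (h : ∀ x y v, (m1 x y).bind (fun w => m2 w v) = (m3 y v).bind (fun w => m4 x w))
    (a : L1 X) (b : L1 Y) (c : L1 V) :
    conv m2 (conv m1 a b) c = conv m4 a (conv m3 b c) := by
  have e1 : ∀ x y, (conv m2 (conv m1 (delta x) (delta y))) =
      (conv m4 (delta x)).comp (conv m3 (delta y)) := by
    intro x y
    refine l1_ext fun v => ?_
    simp [conv_delta, conv_odelta_left, conv_odelta_right, h]
  have e2 : ∀ x, (((conv m2).flip c).comp (conv m1 (delta x))) =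
      (conv m4 (delta x)).comp ((conv m3).flip c) := by
    intro x
    refine l1_ext fun y => ?_
    simpa using congrArg (fun f => f c) (e1 x y)
  have e3 : (((conv m2).flip c).comp ((conv m1).flip b)) = (conv m4).flip (conv m3 b c) := by
    refine l1_ext fun x => ?_
    simpa using congrArg (fun f => f b) (e2 x)
  simpa using congrArg (fun f => f a) e3

section Proj
variable {E F T : Type} [SeminormedAddCommGroup E] [NormedSpace ℂ E]
    [SeminormedAddCommGroup F] [NormedSpace ℂ F]
    [SeminormedAddCommGroup T] [NormedSpace ℂ T] {φ : E →ₗ[ℂ] F →ₗ[ℂ] T}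

theorem projNorm_tmul_le (x : E) (y : F) : projNorm (x ⊗ₜ[ℂ] y) ≤ ‖x‖ * ‖y‖ := by
  refine csInf_le ⟨0, ?_⟩ ⟨1, fun _ => x, fun _ => y, by simp, by simp⟩
  rintro r ⟨n, x, y, -, rfl⟩
  positivity

theorem proj_norm_le (h : IsProjTensor E F T φ) (x : E) (y : F) : ‖φ x y‖ ≤ ‖x‖ * ‖y‖ := by
  have := h.isometry (x ⊗ₜ y)
  rw [TensorProduct.lift.tmul] at this
  rw [this]
  exact projNorm_tmul_le x y

theorem exists_rep (z : E ⊗[ℂ] F) :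
    ∃ (n : ℕ) (x : Fin n → E) (y : Fin n → F), z = ∑ i, x i ⊗ₜ[ℂ] y i := by
  obtain ⟨s, hs⟩ := TensorProduct.exists_finset z
  refine ⟨s.card, fun i => (s.equivFin.symm i).1.1, fun i => (s.equivFin.symm i).1.2, ?_⟩
  rw [hs, ← Finset.sum_coe_sort s]
  exact (Equiv.sum_comp s.equivFin.symm (fun i : s => i.1.1 ⊗ₜ[ℂ] i.1.2)).symm

theorem lift_norm_le {W : Type} [NormedAddCommGroup W] [NormedSpace ℂ W]
    (B : E →ₗ[ℂ] F →ₗ[ℂ] W) (hB : ∀ x y, ‖B x y‖ ≤ ‖x‖ * ‖y‖) (z : E ⊗[ℂ] F) :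
    ‖TensorProduct.lift B z‖ ≤ projNorm z := by
  obtain ⟨n, x, y, hz⟩ := exists_rep z
  refine le_csInf ⟨_, n, x, y, hz, rfl⟩ ?_
  rintro r ⟨n, x, y, rfl, rfl⟩
  rw [map_sum]
  refine (norm_sum_le _ _).trans (Finset.sum_le_sum fun i _ => ?_)
  simpa using hB (x i) (y i)

theorem proj_exists_ext (h : IsProjTensor E F T φ) {W : Type} [NormedAddCommGroup W]
    [NormedSpace ℂ W] [CompleteSpace W]
    (B : E →ₗ[ℂ] F →ₗ[ℂ] W) (hB : ∀ x y, ‖B x y‖ ≤ ‖x‖ * ‖y‖) :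
    ∃ f : T →L[ℂ] W, ∀ x y, f (φ x y) = B x y := by
  refine ⟨(TensorProduct.lift B).extendOfNorm (TensorProduct.lift φ), fun x y => ?_⟩
  have := LinearMap.extendOfNorm_eq (f := TensorProduct.lift B) h.dense
    ⟨1, fun z => by rw [one_mul, h.isometry]; exact lift_norm_le B hB z⟩ (x ⊗ₜ y)
  simpa using this

theorem proj_ext (h : IsProjTensor E F T φ) {W : Type} [NormedAddCommGroup W]
    [NormedSpace ℂ W] {f g : T →L[ℂ] W} (hfg : ∀ x y, f (φ x y) = g (φ x y)) : f = g := by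
  have : (f : T → W) = g := by
    refine h.dense.equalizer f.continuous g.continuous ?_
    funext z
    have : (f : T →ₗ[ℂ] W) ∘ₗ TensorProduct.lift φ = (g : T →ₗ[ℂ] W) ∘ₗ TensorProduct.lift φ := by
      refine TensorProduct.ext' fun x y => ?_
      simpa using hfg x y
    exact congrArg (fun k => k z) this
  exact DFunLike.coe_injective this

end Proj

theorem proj_ext_delta {X Y T W : Type} [SeminormedAddCommGroup T] [NormedSpace ℂ T]
    {φ : L1 X →ₗ[ℂ] L1 Y →ₗ[ℂ] T} (h : IsProjTensor (L1 X) (L1 Y) T φ)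
    [NormedAddCommGroup W] [NormedSpace ℂ W] {f g : T →L[ℂ] W}
    (hfg : ∀ x y, f (φ (delta x) (delta y)) = g (φ (delta x) (delta y))) : f = g := by
  refine proj_ext h fun a b => ?_
  let φc : L1 X →L[ℂ] L1 Y →L[ℂ] T := LinearMap.mkContinuous₂ φ 1
    (fun x y => by rw [one_mul]; exact proj_norm_le h x y)
  have hφ : ∀ a b, φc a b = φ a b := fun a b => rfl
  have e1 : ∀ x, f.comp (φc (delta x)) = g.comp (φc (delta x)) := fun x =>
    l1_ext fun y => by simpa [hφ] using hfg x y
  have e2 : f.comp (φc.flip b) = g.comp (φc.flip b) :=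
    l1_ext fun x => by simpa using congrArg (fun k => k b) (e1 x)
  simpa [hφ] using congrArg (fun k => k a) e2

theorem master {X A Y Z : Type} (r : X → A → Option X) (l : A → Y → Option Y)
    (m : X → Y → Option Z) (u : Z → X) (v : Z → Y)
    (hb : ∀ x a y, (r x a).bind (fun w => m w y) = (l a y).bind (fun w => m x w))
    (hs : ∀ z, m (u z) (v z) = some z)
    (h1 : ∀ x y z, m x y = some z → ∃ a, r (u z) a = some x ∧ l a y = some (v z))
    (h0 : ∀ x y, m x y = none → ∃ a, r x a = some x ∧ l a y = none)
    (T : Type) [SeminormedAddCommGroup T] [NormedSpace ℂ T]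
    (φ : L1 X →ₗ[ℂ] L1 Y →ₗ[ℂ] T) (h : IsProjTensor (L1 X) (L1 Y) T φ) :
    ∃ e : (T ⧸ balancer φ (fun a b => conv r a b) (fun a b => conv l a b)) ≃L[ℂ] L1 Z,
      ∀ a b, e (Submodule.Quotient.mk (φ a b)) = conv m a b := by
  set S := balancer φ (fun a b => conv r a b) (fun a b => conv l a b) with hS
  have hT : CompleteSpace T := h.complete
  have hcl : IsClosed (S : Set T) := Submodule.isClosed_topologicalClosure _
  have hrel : ∀ x a y, (Submodule.Quotient.mk (φ (conv r x a) y) : T ⧸ S) =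
      Submodule.Quotient.mk (φ x (conv l a y)) := by
    intro x a y
    rw [Submodule.Quotient.eq]
    exact Submodule.le_topologicalClosure _ (Submodule.subset_span ⟨x, a, y, rfl⟩)
  obtain ⟨Φ, hΦ⟩ := proj_exists_ext h
    (LinearMap.mk₂ ℂ (fun a b => conv m a b) (by simp) (by simp) (by simp) (by simp))
    (fun a b => norm_conv_le m a b)
  replace hΦ : ∀ a b, Φ (φ a b) = conv m a b := hΦ
  have hker : S ≤ LinearMap.ker (Φ : T →ₗ[ℂ] L1 Z) := by
    refine Submodule.topologicalClosure_minimal _ ?_ Φ.isClosed_ker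
    rw [Submodule.span_le]
    rintro _ ⟨x, a, y, rfl⟩
    simp [hΦ, conv_assoc r m l m hb]
  let Φq : (T ⧸ S) →L[ℂ] L1 Z :=
    ⟨S.liftQ (Φ : T →ₗ[ℂ] L1 Z) hker, Φ.continuous.quotient_lift _⟩
  have hΦq : ∀ t, Φq (Submodule.Quotient.mk t) = Φ t := fun t => rfl
  let π : T →L[ℂ] (T ⧸ S) := S.mkQL
  have hπ : ∀ t, π t = Submodule.Quotient.mk t := fun t => rfl
  let Ψ : L1 Z →L[ℂ] (T ⧸ S) := l1lift
    (fun z => (Submodule.Quotient.mk (φ (delta (u z)) (delta (v z))) : T ⧸ S)) (fun z => by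
      refine (Submodule.Quotient.norm_mk_le S _).trans ((proj_norm_le h _ _).trans ?_)
      simp [norm_delta])
  have hΨ : ∀ z, Ψ (delta z) = Submodule.Quotient.mk (φ (delta (u z)) (delta (v z))) :=
    fun z => l1lift_delta _ _ z
  have hright : Φq.comp Ψ = ContinuousLinearMap.id ℂ _ := by
    refine l1_ext fun z => ?_
    simp [hΨ, hΦq, hΦ, conv_delta, hs, odelta]
  have hleft : Ψ.comp Φ = π := by
    refine proj_ext_delta h fun x y => ?_
    simp only [ContinuousLinearMap.comp_apply, hΦ, conv_delta, hπ]
    rcases hm : m x y with _ | z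
    · obtain ⟨a, ha, hl⟩ := h0 x y hm
      have := hrel (delta x) (delta a) (delta y)
      simp only [conv_delta, ha, hl, odelta, map_zero] at this
      simp [odelta, this]
    · obtain ⟨a, ha, hl⟩ := h1 x y z hm
      have := hrel (delta (u z)) (delta a) (delta y)
      simp only [conv_delta, ha, hl, odelta] at this
      simp [odelta, this, hΨ]
  refine ⟨ContinuousLinearEquiv.equivOfInverse Φq Ψ ?_ ?_, fun a b => ?_⟩
  · intro q
    obtain ⟨t, rfl⟩ := Submodule.Quotient.mk_surjective _ q
    exact congrArg (fun k => k t) hleft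
  · intro z
    exact congrArg (fun k => k z) hright
  · exact hΦ a b

open Classical in
/-- Matrix-unit composition. -/
def comp {G J K L X Y Z : Type} [Mul G] (eX : X ≃ J × G × K) (eY : Y ≃ K × G × L)
    (eZ : Z ≃ J × G × L) (x : X) (y : Y) : Option Z :=
  if (eX x).2.2 = (eY y).1 then
    some (eZ.symm ((eX x).1, (eX x).2.1 * (eY y).2.1, (eY y).2.2)) else none

theorem comp_assoc {G J K L M X Y V XY YV Z : Type} [Group G]
    (eX : X ≃ J × G × K) (eY : Y ≃ K × G × L) (eV : V ≃ L × G × M)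
    (eXY : XY ≃ J × G × L) (eYV : YV ≃ K × G × M) (eZ : Z ≃ J × G × M) (x : X) (y : Y) (v : V) :
    (comp eX eY eXY x y).bind (fun w => comp eXY eV eZ w v) =
      (comp eY eV eYV y v).bind (fun w => comp eX eYV eZ x w) := by
  unfold comp
  by_cases h : (eX x).2.2 = (eY y).1 <;> by_cases h' : (eY y).2.2 = (eV v).1 <;>
    simp [h, h', mul_assoc]

/-- The convolution attached to matrix-unit composition. -/
def cc {G J K L X Y Z : Type} [Mul G] (eX : X ≃ J × G × K) (eY : Y ≃ K × G × L)
    (eZ : Z ≃ J × G × L) : L1 X →L[ℂ] L1 Y →L[ℂ] L1 Z := conv (comp eX eY eZ)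

theorem cc_assoc {G J K L M X Y V XY YV Z : Type} [Group G]
    (eX : X ≃ J × G × K) (eY : Y ≃ K × G × L) (eV : V ≃ L × G × M)
    (eXY : XY ≃ J × G × L) (eYV : YV ≃ K × G × M) (eZ : Z ≃ J × G × M)
    (a : L1 X) (b : L1 Y) (c : L1 V) :
    cc eXY eV eZ (cc eX eY eXY a b) c = cc eX eYV eZ a (cc eY eV eYV b c) :=
  conv_assoc _ _ _ _ (comp_assoc eX eY eV eXY eYV eZ) a b c

theorem cc_master {G J K L X A Y Z : Type} [Group G] [Nonempty K]
    (eX : X ≃ J × G × K) (eA : A ≃ K × G × K) (eY : Y ≃ K × G × L) (eZ : Z ≃ J × G × L)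
    (T : Type) [SeminormedAddCommGroup T] [NormedSpace ℂ T]
    (φ : L1 X →ₗ[ℂ] L1 Y →ₗ[ℂ] T) (h : IsProjTensor (L1 X) (L1 Y) T φ) :
    ∃ e : (T ⧸ balancer φ (fun a b => cc eX eA eX a b) (fun a b => cc eA eY eY a b)) ≃L[ℂ] L1 Z,
      ∀ a b, e (Submodule.Quotient.mk (φ a b)) = cc eX eY eZ a b := by
  obtain ⟨k⟩ := ‹Nonempty K›
  refine master (comp eX eA eX) (comp eA eY eY) (comp eX eY eZ)
    (fun z => eX.symm ((eZ z).1, (eZ z).2.1, k)) (fun z => eY.symm (k, 1, (eZ z).2.2))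
    (comp_assoc eX eA eY eX eY eZ) ?_ ?_ ?_ T φ h
  · intro z
    simp [comp]
  · intro x y z hz
    refine ⟨eA.symm (k, (eY y).2.1⁻¹, (eY y).1), ?_⟩
    unfold comp at hz
    split_ifs at hz with hxy
    obtain rfl := Option.some.inj hz
    simp [comp, ← hxy]
  · intro x y hxy
    refine ⟨eA.symm ((eX x).2.2, 1, (eX x).2.2), ?_⟩
    unfold comp at hxy
    split_ifs at hxy with hxy'
    simp [comp, hxy']

/-- `G` as the one-by-one matrix units over `G`. -/
def eqG (G : Type) : G ≃ Unit × G × Unit where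
  toFun g := ((), g, ())
  invFun p := p.2.1
  left_inv _ := rfl
  right_inv _ := rfl

theorem mulT_apply {I G : Type} [Group G] (a b : L1 (I × G × I)) (i : I) (g : G) (j : I) :
    cc (Equiv.refl (I × G × I)) (Equiv.refl (I × G × I)) (Equiv.refl (I × G × I)) a b (i, g, j) =
      ∑' p : I × G, a (i, g * p.2⁻¹, p.1) * b (p.1, p.2, j) := by
  classical
  unfold cc
  rw [conv_apply]
  let ι : I × G → (I × G × I) × (I × G × I) :=
    fun p => ((i, g * p.2⁻¹, p.1), (p.1, p.2, j))
  have hι : Function.Injective ι := by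
    rintro ⟨k, h⟩ ⟨k', h'⟩ he
    simp only [ι, Prod.mk.injEq] at he
    exact Prod.ext he.2.1 he.2.2.1
  rw [← hι.tsum_eq]
  · congr 1
    ext p
    simp [ι, comp]
  · rintro ⟨⟨i1, g1, k1⟩, ⟨k2, g2, j2⟩⟩ hp
    rw [Function.mem_support] at hp
    have hc : comp (Equiv.refl (I × G × I)) (Equiv.refl (I × G × I)) (Equiv.refl (I × G × I))
        (i1, g1, k1) (k2, g2, j2) = some (i, g, j) := by
      by_contra hne
      exact hp (if_neg hne)
    unfold comp at hc
    split_ifs at hc with hk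
    simp only [Option.some.injEq, Prod.mk.injEq, Equiv.refl_apply, Equiv.refl_symm] at hc hk
    obtain ⟨rfl, rfl, rfl⟩ := hc
    subst hk
    exact ⟨(k1, g2), by simp [ι]⟩

theorem mulG_apply {G : Type} [Group G] (x y : L1 G) (g : G) :
    cc (eqG G) (eqG G) (eqG G) x y g = l1conv x y g := by
  unfold cc
  rw [conv_apply]
  have hc : ∀ a b : G, comp (eqG G) (eqG G) (eqG G) a b = some (a * b) := fun a b => if_pos rfl
  unfold l1conv
  refine tsum_congr fun p => ?_
  by_cases h : p.1 * p.2 = g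
  · rw [if_pos h, if_pos (by rw [hc, h])]
  · rw [if_neg h, if_neg (by rw [hc]; simpa using h)]

end Helpers

/-- For a discrete group `G` and a nonempty set `I`, the Banach
algebra `ℓ¹(T)` (`T = I×G×I`) is self-induced and Morita equivalent (in the sense of
Grønbæk) to the group algebra `ℓ¹(G)`. -/
theorem brandt_morita_stmt10 (I G : Type) [Nonempty I] [Group G] :
    ∃ (mulT : L1 (I × G × I) →L[ℂ] L1 (I × G × I) →L[ℂ] L1 (I × G × I))
      (mulG : L1 G →L[ℂ] L1 G →L[ℂ] L1 G),
      (∀ (a b : L1 (I × G × I)) (i : I) (g : G) (j : I),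
        mulT a b (i, g, j) = ∑' p : I × G, a (i, g * p.2⁻¹, p.1) * b (p.1, p.2, j)) ∧
      (∀ (x y : L1 G) (g : G), mulG x y g = l1conv x y g) ∧
      SelfInduced mulT ∧
      MoritaEquivalent mulT mulG := by
  let eA : (I × G × I) ≃ I × G × I := Equiv.refl _
  let eB : G ≃ Unit × G × Unit := eqG G
  let eP : (Unit × G × I) ≃ Unit × G × I := Equiv.refl _
  let eQ : (I × G × Unit) ≃ I × G × Unit := Equiv.refl _
  refine ⟨cc eA eA eA, cc eB eB eB, mulT_apply, mulG_apply, ?_, ⟨?_⟩⟩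
  · intro T _ _ φ h
    obtain ⟨e, he⟩ := cc_master eA eA eA eA T φ h
    refine ⟨e, he, fun c a b => ?_, fun a b c => ?_⟩
    · rw [he, he, cc_assoc]
    · rw [he, he, cc_assoc]
  · exact
    { P := L1 (Unit × G × I)
      Q := L1 (I × G × Unit)
      lP := cc eB eP eP
      rP := cc eP eA eP
      lQ := cc eA eQ eQ
      rQ := cc eQ eB eQ
      lawP := ⟨fun _ _ _ => cc_assoc .., fun _ _ _ => cc_assoc .., fun _ _ _ => cc_assoc ..⟩
      lawQ := ⟨fun _ _ _ => cc_assoc .., fun _ _ _ => cc_assoc .., fun _ _ _ => cc_assoc ..⟩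
      indPl := fun T _ _ φ h => cc_master eB eB eP eP T φ h
      indPr := fun T _ _ φ h => cc_master eP eA eA eP T φ h
      indQl := fun T _ _ φ h => cc_master eA eA eQ eQ T φ h
      indQr := fun T _ _ φ h => cc_master eQ eB eB eQ T φ h
      isoB := fun T _ _ φ h => by
        obtain ⟨e, he⟩ := cc_master eP eA eQ eB T φ h
        refine ⟨e, fun b p q => ?_, fun b p q => ?_⟩
        · rw [he, he, cc_assoc]
        · rw [he, he, cc_assoc]
      isoA := fun T _ _ φ h => by
        obtain ⟨e, he⟩ := cc_master eQ eB eP eA T φ h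
        refine ⟨e, fun b p q => ?_, fun b p q => ?_⟩
        · rw [he, he, cc_assoc]
        · rw [he, he, cc_assoc] }
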